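/- (Twofold rule.) Let n ≥ 3 and fix an arbitrary assignment of mosaic tiles to the (n−2)×(n−2) inner positions of an n×n mosaic board (the positions whose row and column indices are strictly between the first and last). Then the number of ways to assign undecorated tiles (tiles from T0–T8, i.e., the empty tile, arc tiles, line tiles, and double-arc tiles) to the remaining boundary positions so that the resulting n-mosaic is suitably connected is at most two. -/

import Mathlib

/-- The 15 mosaic tiles. -/
inductive Tile where
  | T0 | T1 | T2 | T3 | T4 | T5 | T6 | T7 | T8 | T9 | T10 | T11 | T12 | T13 | T14
  deriving DecidableEq

instance : Fintype Tile where
  elems := ⟨[Tile.T0, Tile.T1, Tile.T2, Tile.T3, Tile.T4, Tile.T5, Tile.T6, Tile.T7, Tile.T8,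
    Tile.T9, Tile.T10, Tile.T11, Tile.T12, Tile.T13, Tile.T14], by decide⟩
  complete := by intro x; cases x <;> decide

namespace Tile

/-- Whether a tile has a connection point on its top edge. -/
def top : Tile → Bool
  | T3 | T4 | T6 | T7 | T8 | T9 | T10 | T11 | T12 | T13 | T14 => true
  | _ => false

/-- Whether a tile has a connection point on its bottom edge. -/
def bottom : Tile → Bool
  | T1 | T2 | T6 | T7 | T8 | T9 | T10 | T11 | T12 | T13 | T14 => true
  | _ => false

/-- Whether a tile has a connection point on its left edge. -/
def left : Tile → Bool
  | T1 | T4 | T5 | T7 | T8 | T9 | T10 | T11 | T12 | T13 | T14 => true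
  | _ => false

/-- Whether a tile has a connection point on its right edge. -/
def right : Tile → Bool
  | T2 | T3 | T5 | T7 | T8 | T9 | T10 | T11 | T12 | T13 | T14 => true
  | _ => false

end Tile

/-- An (m,n)-mosaic (rows indexed by `Fin m`, columns by `Fin n`) is suitably connected if
every connection point of every tile coincides with a connection point of a contiguous tile. -/
def SuitablyConnected {m n : ℕ} (M : Fin m → Fin n → Tile) : Prop :=
  ∀ (i : Fin m) (j : Fin n),
    ((M i j).top = true → ∃ i' : Fin m, i'.val + 1 = i.val ∧ (M i' j).bottom = true) ∧
    ((M i j).bottom = true → ∃ i' : Fin m, i.val + 1 = i'.val ∧ (M i' j).top = true) ∧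
    ((M i j).left = true → ∃ j' : Fin n, j'.val + 1 = j.val ∧ (M i j').right = true) ∧
    ((M i j).right = true → ∃ j' : Fin n, j.val + 1 = j'.val ∧ (M i j').left = true)

namespace Twofold

/-- Extension of a mosaic to all natural positions by empty tiles. -/
def ext {n : ℕ} (M : Fin n → Fin n → Tile) (i j : ℕ) : Tile :=
  if h : i < n ∧ j < n then M ⟨i, h.1⟩ ⟨j, h.2⟩ else Tile.T0

theorem ext_of {n : ℕ} (M : Fin n → Fin n → Tile) {i j : ℕ} (hi : i < n) (hj : j < n) :
    ext M i j = M ⟨i, hi⟩ ⟨j, hj⟩ := by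
  simp [ext, hi, hj]

theorem ext_out {n : ℕ} (M : Fin n → Fin n → Tile) {i j : ℕ} (h : n ≤ i ∨ n ≤ j) :
    ext M i j = Tile.T0 := by
  unfold ext
  rw [dif_neg]
  omega

theorem parity (t : Tile) : t.right = (t.left ^^ (t.top ^^ t.bottom)) := by
  cases t <;> rfl

theorem tile_eq (s t : Tile)
    (hs : s ∈ ([Tile.T0, Tile.T1, Tile.T2, Tile.T3, Tile.T4, Tile.T5, Tile.T6,
                    Tile.T7, Tile.T8] : List Tile))
    (ht : t ∈ ([Tile.T0, Tile.T1, Tile.T2, Tile.T3, Tile.T4, Tile.T5, Tile.T6,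
                    Tile.T7, Tile.T8] : List Tile))
    (h1 : s.top = t.top) (h2 : s.bottom = t.bottom) (h3 : s.left = t.left)
    (h4 : s.right = t.right)
    (h : s.top = false ∨ s.bottom = false ∨ s.left = false ∨ s.right = false) : s = t := by
  revert s t
  decide

/-- The edge conditions for the extended mosaic. -/
structure Good (n : ℕ) (m : ℕ → ℕ → Tile) : Prop where
  hor : ∀ i j, (m i j).right = (m i (j + 1)).left
  ver : ∀ i j, (m i j).bottom = (m (i + 1) j).top
  top : ∀ j, (m 0 j).top = false
  left : ∀ i, (m i 0).left = false
  bottom : ∀ j, (m (n - 1) j).bottom = false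
  right : ∀ i, (m i (n - 1)).right = false

theorem good {n : ℕ} (hn : 3 ≤ n) {M : Fin n → Fin n → Tile} (h : SuitablyConnected M) :
    Good n (ext M) := by
  have T : ∀ i j, (ext M i j).top = true → ∃ k, k + 1 = i ∧ (ext M k j).bottom = true := by
    intro i j hb
    by_cases hij : i < n ∧ j < n
    · rw [ext_of M hij.1 hij.2] at hb
      obtain ⟨k, hk, hk'⟩ := (h ⟨i, hij.1⟩ ⟨j, hij.2⟩).1 hb
      exact ⟨k, hk, by rw [ext_of M k.2 hij.2]; exact hk'⟩
    · rw [ext_out M (by omega)] at hb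
      simp [Tile.top] at hb
  have B : ∀ i j, (ext M i j).bottom = true → i + 1 < n ∧ (ext M (i + 1) j).top = true := by
    intro i j hb
    by_cases hij : i < n ∧ j < n
    · rw [ext_of M hij.1 hij.2] at hb
      obtain ⟨k, hk, hk'⟩ := (h ⟨i, hij.1⟩ ⟨j, hij.2⟩).2.1 hb
      simp only at hk
      rw [hk]
      exact ⟨k.2, by rw [ext_of M k.2 hij.2]; exact hk'⟩
    · rw [ext_out M (by omega)] at hb
      simp [Tile.bottom] at hb
  have L : ∀ i j, (ext M i j).left = true → ∃ k, k + 1 = j ∧ (ext M i k).right = true := by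
    intro i j hb
    by_cases hij : i < n ∧ j < n
    · rw [ext_of M hij.1 hij.2] at hb
      obtain ⟨k, hk, hk'⟩ := (h ⟨i, hij.1⟩ ⟨j, hij.2⟩).2.2.1 hb
      exact ⟨k, hk, by rw [ext_of M hij.1 k.2]; exact hk'⟩
    · rw [ext_out M (by omega)] at hb
      simp [Tile.left] at hb
  have R : ∀ i j, (ext M i j).right = true → j + 1 < n ∧ (ext M i (j + 1)).left = true := by
    intro i j hb
    by_cases hij : i < n ∧ j < n
    · rw [ext_of M hij.1 hij.2] at hb
      obtain ⟨k, hk, hk'⟩ := (h ⟨i, hij.1⟩ ⟨j, hij.2⟩).2.2.2 hb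
      simp only at hk
      rw [hk]
      exact ⟨k.2, by rw [ext_of M hij.1 k.2]; exact hk'⟩
    · rw [ext_out M (by omega)] at hb
      simp [Tile.right] at hb
  refine ⟨fun i j => ?_, fun i j => ?_, fun j => ?_, fun i => ?_, fun j => ?_, fun i => ?_⟩
  · rw [Bool.eq_iff_iff]
    refine ⟨fun h => (R i j h).2, fun h => ?_⟩
    obtain ⟨k, hk, hk'⟩ := L _ _ h
    obtain rfl : k = j := by omega
    exact hk'
  · rw [Bool.eq_iff_iff]
    refine ⟨fun h => (B i j h).2, fun h => ?_⟩
    obtain ⟨k, hk, hk'⟩ := T _ _ h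
    obtain rfl : k = i := by omega
    exact hk'
  · rw [Bool.eq_false_iff]
    intro h
    obtain ⟨k, hk, -⟩ := T _ _ h
    omega
  · rw [Bool.eq_false_iff]
    intro h
    obtain ⟨k, hk, -⟩ := L _ _ h
    omega
  · rw [Bool.eq_false_iff]
    intro h
    have := (B _ _ h).1
    omega
  · rw [Bool.eq_false_iff]
    intro h
    have := (R _ _ h).1
    omega

/-- Four-term parity: agreement on three sides forces agreement on the fourth. -/
theorem right_eq {s t : Tile} (h1 : s.left = t.left) (h2 : s.top = t.top)
    (h3 : s.bottom = t.bottom) : s.right = t.right := by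
  rw [parity, parity, h1, h2, h3]

theorem bottom_eq {s t : Tile} (h1 : s.left = t.left) (h2 : s.top = t.top)
    (h3 : s.right = t.right) : s.bottom = t.bottom := by
  rw [parity, parity, h1, h2] at h3
  simpa using h3

theorem sides {n : ℕ} (hn : 3 ≤ n) {a b : ℕ → ℕ → Tile} (ha : Good n a) (hb : Good n b)
    (hin : ∀ i j, 0 < i → i < n - 1 → 0 < j → j < n - 1 → a i j = b i j)
    (h0 : (a 0 0).right = (b 0 0).right) :
    (∀ i j, i < n → j < n → (a i j).right = (b i j).right) ∧
    (∀ i j, i < n → j < n → (a i j).bottom = (b i j).bottom) := by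
  obtain ⟨n, rfl⟩ : ∃ k, n = k + 3 := ⟨n - 3, by omega⟩
  obtain ⟨ah, av, at', al, ab, ar⟩ := ha
  obtain ⟨bh, bv, bt, bl, bb, br⟩ := hb
  simp only [Nat.add_sub_cancel, show n + 3 - 1 = n + 2 by omega] at *
  have top : ∀ j, j < n + 2 → (a 0 j).right = (b 0 j).right := by
    intro j
    induction j with
    | zero => intro _; exact h0
    | succ j ih =>
      intro hj
      apply right_eq
      · rw [← ah, ← bh]; exact ih (by omega)
      · rw [at', bt]
      · rw [av, bv, hin] <;> omega
  have lef : ∀ i, i < n + 2 → (a i 0).bottom = (b i 0).bottom := by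
    intro i
    induction i with
    | zero =>
      intro _
      exact bottom_eq (by rw [al, bl]) (by rw [at', bt]) h0
    | succ i ih =>
      intro hi
      apply bottom_eq
      · rw [al, bl]
      · rw [← av, ← bv]; exact ih (by omega)
      · rw [ah, bh, hin] <;> omega
  have rig : ∀ i, i < n + 2 → (a i (n + 2)).bottom = (b i (n + 2)).bottom := by
    intro i
    induction i with
    | zero =>
      intro _
      exact bottom_eq (by rw [← ah, ← bh]; exact top _ (by omega)) (by rw [at', bt])
        (by rw [ar, br])
    | succ i ih =>
      intro hi
      apply bottom_eq
      · rw [← ah, ← bh, hin] <;> omega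
      · rw [← av, ← bv]; exact ih (by omega)
      · rw [ar, br]
  have bot : ∀ j, j < n + 2 → (a (n + 2) j).right = (b (n + 2) j).right := by
    intro j
    induction j with
    | zero =>
      intro _
      exact right_eq (by rw [al, bl]) (by rw [← av, ← bv]; exact lef _ (by omega))
        (by rw [ab, bb])
    | succ j ih =>
      intro hj
      apply right_eq
      · rw [← ah, ← bh]; exact ih (by omega)
      · rw [← av, ← bv, hin] <;> omega
      · rw [ab, bb]
  constructor
  · intro i j hi hj
    by_cases j2 : j = n + 2
    · rw [j2, ar, br]
    by_cases i0 : i = 0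
    · rw [i0]; exact top j (by omega)
    by_cases i2 : i = n + 2
    · rw [i2]; exact bot j (by omega)
    by_cases j0 : j = 0
    · rw [j0, ah, bh, hin] <;> omega
    rw [hin] <;> omega
  · intro i j hi hj
    by_cases i2 : i = n + 2
    · rw [i2, ab, bb]
    by_cases j0 : j = 0
    · rw [j0]; exact lef i (by omega)
    by_cases j2 : j = n + 2
    · rw [j2]; exact rig i (by omega)
    by_cases i0 : i = 0
    · rw [i0, av, bv, hin] <;> omega
    rw [hin] <;> omega

end Twofold

/-- Twofold rule: For n ≥ 3 and any fixed assignment of tiles to the inner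
positions of an n×n board, there are at most two ways to fill the boundary positions with
undecorated tiles (T0–T8) so that the resulting n-mosaic is suitably connected. -/
theorem twofold_rule {n : ℕ} (hn : 3 ≤ n) (inner : Fin n → Fin n → Tile) :
    {M : Fin n → Fin n → Tile |
        (∀ i j : Fin n, 0 < i.val → i.val < n - 1 → 0 < j.val → j.val < n - 1 →
          M i j = inner i j) ∧
        (∀ i j : Fin n, (i.val = 0 ∨ i.val = n - 1 ∨ j.val = 0 ∨ j.val = n - 1) →
          M i j ∈ ([Tile.T0, Tile.T1, Tile.T2, Tile.T3, Tile.T4, Tile.T5, Tile.T6,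
                    Tile.T7, Tile.T8] : List Tile)) ∧
        SuitablyConnected M}.ncard ≤ 2 := by
  refine (Set.ncard_le_ncard_of_injOn (t := (Set.univ : Set Bool))
    (fun M => (Twofold.ext M 0 0).right) (fun _ _ => Set.mem_univ _) ?_ Set.finite_univ).trans ?_
  · rintro M ⟨hM1, hM2, hM3⟩ N ⟨hN1, hN2, hN3⟩ h0
    have gM := Twofold.good hn hM3
    have gN := Twofold.good hn hN3
    obtain ⟨hR, hB⟩ := Twofold.sides hn gM gN (by
      intro i j h1 h2 h3 h4
      rw [Twofold.ext_of M (show i < n by omega) (show j < n by omega),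
        Twofold.ext_of N (show i < n by omega) (show j < n by omega),
        hM1 _ _ h1 h2 h3 h4, hN1 _ _ h1 h2 h3 h4]) h0
    funext i j
    by_cases hij : i.val = 0 ∨ i.val = n - 1 ∨ j.val = 0 ∨ j.val = n - 1
    · have eM : Twofold.ext M i j = M i j := Twofold.ext_of M i.2 j.2
      have eN : Twofold.ext N i j = N i j := Twofold.ext_of N i.2 j.2
      refine Twofold.tile_eq _ _ (hM2 i j hij) (hN2 i j hij) ?_ ?_ ?_ ?_ ?_
      · rw [← eM, ← eN]
        rcases hi : i.val with _ | k
        · rw [gM.top, gN.top]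
        · rw [← gM.ver, ← gN.ver]
          exact hB _ _ (by omega) j.2
      · rw [← eM, ← eN]
        exact hB _ _ i.2 j.2
      · rw [← eM, ← eN]
        rcases hj : j.val with _ | k
        · rw [gM.left, gN.left]
        · rw [← gM.hor, ← gN.hor]
          exact hR _ _ i.2 (by omega)
      · rw [← eM, ← eN]
        exact hR _ _ i.2 j.2
      · rw [← eM]
        rcases hij with h | h | h | h <;> rw [h]
        · exact Or.inl (gM.top _)
        · exact Or.inr (Or.inl (gM.bottom _))
        · exact Or.inr (Or.inr (Or.inl (gM.left _)))
        · exact Or.inr (Or.inr (Or.inr (gM.right _)))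
    · rw [hM1 i j (by omega) (by omega) (by omega) (by omega),
        hN1 i j (by omega) (by omega) (by omega) (by omega)]
  · simp [Set.ncard_univ]
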